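/- Coupling of chains with equal magnetization: for every β ≥ 0 there exists a constant c₀(β) such that for all n large enough and all σ, σ̃ ∈ Ω with S(σ) = S(σ̃), there is a coupling (X_t, X̃_t) of the Glauber dynamics with X_0 = σ and X̃_0 = σ̃ whose coupling time τ := min{t ≥ 0 : X_t = X̃_t} satisfies P(τ > c₀(β)·n·log n) ≤ 1/n. -/

import Mathlib

open Filter Real

namespace CW

/-- Configurations of the Curie-Weiss model on `n` vertices:
`true` encodes spin `+1` and `false` encodes spin `-1`. -/
abbrev Config (n : ℕ) := Fin n → Bool

noncomputable section

/-- The spin (±1) at site `i`. -/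
def spin {n : ℕ} (σ : Config n) (i : Fin n) : ℝ := if σ i then 1 else -1

/-- Normalized magnetization `S(σ) = n⁻¹ ∑ᵢ σ(i)`. -/
def mag {n : ℕ} (σ : Config n) : ℝ := (∑ i, spin σ i) / n

/-- `p₊(s) = (1 + tanh(βs))/2`. -/
def pPlus (β s : ℝ) : ℝ := (1 + Real.tanh (β * s)) / 2

/-- One-step transition kernel of the Glauber dynamics for the Curie-Weiss
model: a uniformly chosen site `i` is refreshed, becoming `+1` with
probability `p₊(S(σ) - σ(i)/n)`. -/
def glauberKernel (β : ℝ) (n : ℕ) (σ η : Config n) : ℝ :=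
  (1 / n) * ∑ i : Fin n,
    if ∀ j, j ≠ i → η j = σ j then
      (if η i then pPlus β (mag σ - spin σ i / n)
       else 1 - pPlus β (mag σ - spin σ i / n))
    else 0

/-- Law of the Glauber dynamics at time `t` started from `σ`. -/
def glauberLaw (β : ℝ) (n : ℕ) : ℕ → Config n → Config n → ℝ
  | 0, σ, η => if η = σ then 1 else 0
  | t + 1, σ, η => ∑ τ : Config n, glauberLaw β n t σ τ * glauberKernel β n τ η

/-- The (normalized) exponent in the Curie-Weiss measure. -/
def cwExponent {n : ℕ} (β : ℝ) (σ : Config n) : ℝ :=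
  (β / n) * ∑ i : Fin n, ∑ j : Fin n, if i < j then spin σ i * spin σ j else 0

/-- The Curie-Weiss (mean-field Ising) probability measure
`μ(σ) = Z(β)⁻¹ exp((β/n) ∑_{i<j} σ(i)σ(j))`. -/
def cwMeasure (β : ℝ) (n : ℕ) (σ : Config n) : ℝ :=
  Real.exp (cwExponent β σ) / ∑ η : Config n, Real.exp (cwExponent β η)

/-- Total variation distance between two (discrete) distributions. -/
def tvDist {Ω : Type*} [Fintype Ω] (μ ν : Ω → ℝ) : ℝ :=
  (∑ x, |μ x - ν x|) / 2

/-- Worst-case total variation distance to stationarity at time `t`. -/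
def glauberDist (β : ℝ) (n t : ℕ) : ℝ :=
  ⨆ σ : Config n, tvDist (glauberLaw β n t σ) (cwMeasure β n)

/-- Hamming distance between two configurations,
`dist(σ, σ') = (1/2) ∑ᵢ |σ(i) - σ'(i)|`. -/
def hamming {n : ℕ} (σ τ : Config n) : ℝ := (∑ i, |spin σ i - spin τ i|) / 2

/-- `P` is (the path measure of) a coupling of two copies of the Glauber
dynamics started from `σ` and `σ'`: the first coordinate process is a version
of the Glauber dynamics started at `σ` (its finite-dimensional distributions
are those of the chain), and similarly for the second coordinate started
at `σ'`. -/
def IsPathCoupling (β : ℝ) (n : ℕ) (σ σ' : Config n)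
    (P : MeasureTheory.Measure (ℕ → Config n × Config n)) : Prop :=
  MeasureTheory.IsProbabilityMeasure P ∧
  (∀ (T : ℕ) (w : ℕ → Config n),
    P {ω | ∀ t ≤ T, (ω t).1 = w t} =
      ENNReal.ofReal ((if w 0 = σ then 1 else 0) *
        ∏ t ∈ Finset.range T, glauberKernel β n (w t) (w (t + 1)))) ∧
  (∀ (T : ℕ) (w : ℕ → Config n),
    P {ω | ∀ t ≤ T, (ω t).2 = w t} =
      ENNReal.ofReal ((if w 0 = σ' then 1 else 0) *
        ∏ t ∈ Finset.range T, glauberKernel β n (w t) (w (t + 1))))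

open MeasureTheory in
/-- An i.i.d. sequence is its first term followed by an independent i.i.d. sequence. -/
theorem infinitePi_eq_map_cons {N : Type*} [MeasurableSpace N] (ν : Measure N)
    [IsProbabilityMeasure ν] :
    (ν.prod (Measure.infinitePi fun _ : ℕ => ν)).map
        (fun p k => Nat.casesOn (motive := fun _ => N) k p.1 p.2) =
      Measure.infinitePi fun _ : ℕ => ν := by
  have hmeas : Measurable fun (p : N × (ℕ → N)) (k : ℕ) =>
      Nat.casesOn (motive := fun _ => N) k p.1 p.2 := by
    refine measurable_pi_lambda _ fun k => ?_
    cases k with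
    | zero => exact measurable_fst
    | succ k => exact (measurable_pi_apply k).comp measurable_snd
  classical
  refine Measure.eq_infinitePi _ fun s t ht => ?_
  obtain ⟨M, hM⟩ := s.exists_nat_subset_range
  set t' : ℕ → Set N := fun i => if i ∈ s then t i else Set.univ with ht'
  have hmt' : ∀ i, MeasurableSet (t' i) := fun i => by
    by_cases h : i ∈ s <;> simp [ht', h, ht i]
  have hprod : ∏ i ∈ s, ν (t i) = ∏ i ∈ Finset.range (M + 1), ν (t' i) := by
    rw [← Finset.prod_subset (hM.trans (Finset.range_mono M.le_succ))
      (fun i _ hi => by simp [ht', hi])]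
    exact Finset.prod_congr rfl fun i hi => by simp [ht', hi]
  have hpre : (fun (p : N × (ℕ → N)) (k : ℕ) =>
      Nat.casesOn (motive := fun _ => N) k p.1 p.2) ⁻¹' Set.pi s t =
      t' 0 ×ˢ Set.pi (Finset.range M) fun i => t' (i + 1) := by
    ext p
    simp only [Set.mem_preimage, Set.mem_pi, Finset.mem_coe, Set.mem_prod, Finset.mem_range, ht']
    constructor
    · intro h
      refine ⟨?_, fun i _ => ?_⟩
      · split_ifs with h0
        exacts [h 0 h0, trivial]
      · split_ifs with h0
        exacts [h (i + 1) h0, trivial]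
    · rintro ⟨h0, h1⟩ i hi
      cases i with
      | zero => simpa [hi] using h0
      | succ i =>
        have : i + 1 < M := Finset.mem_range.1 (hM hi)
        simpa [hi] using h1 i (by omega)
  rw [Measure.map_apply hmeas (.pi s.countable_toSet fun i _ => ht i), hpre, Measure.prod_prod,
    Measure.infinitePi_pi _ (fun i _ => hmt' (i + 1)), hprod, Finset.prod_range_succ', mul_comm]

/-- The trajectory from `s` driven by a sequence of maps. -/
def drivenPath {S : Type*} (s : S) (ξ : ℕ → S → S) : ℕ → S
  | 0 => s
  | t + 1 => ξ t (drivenPath s ξ t)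

theorem drivenPath_succ_eq {S : Type*} (s : S) (ξ : ℕ → S → S) (t : ℕ) :
    drivenPath s ξ (t + 1) = drivenPath (ξ 0 s) (fun k => ξ (k + 1)) t := by
  induction t with
  | zero => rfl
  | succ t ih => rw [drivenPath, ih, drivenPath]

open MeasureTheory in
/-- Markov chains on a finite state space exist, characterized by conditioning on the
first step. -/
theorem exists_markovChain {S : Type*} [Finite S] [MeasurableSpace S]
    [MeasurableSingletonClass S] (Q : S → Measure S) [∀ s, IsProbabilityMeasure (Q s)] :
    ∃ P : S → Measure (ℕ → S), (∀ s, IsProbabilityMeasure (P s)) ∧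
      (∀ s (A : ℕ → Set S), P s {ω | ∀ t ≤ 0, ω t ∈ A t} = (A 0).indicator 1 s) ∧
      ∀ s (A : ℕ → Set S) (T : ℕ), P s {ω | ∀ t ≤ T + 1, ω t ∈ A t} =
        (A 0).indicator (fun _ => ∫⁻ s', P s' {ω | ∀ t ≤ T, ω t ∈ A (t + 1)} ∂Q s) s := by
  have := Fintype.ofFinite S
  set ν : Measure (S → S) := Measure.pi Q
  set μ : Measure (ℕ → S → S) := Measure.infinitePi fun _ => ν
  have hdm : ∀ s : S, Measurable (drivenPath s) := by
    intro s
    refine measurable_pi_lambda _ fun t => ?_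
    induction t with
    | zero => exact measurable_const
    | succ t ih =>
      have : Measurable fun p : (S → S) × S => p.1 p.2 := measurable_of_countable _
      exact this.comp ((measurable_pi_apply t).prodMk ih)
  have hset : ∀ (A : ℕ → Set S) (T : ℕ), MeasurableSet {ω : ℕ → S | ∀ t ≤ T, ω t ∈ A t} := by
    intro A T
    simp only [Set.ofPred_forall]
    exact .iInter fun t => .iInter fun _ => measurable_pi_apply t (Set.toFinite (A t)).measurableSet
  refine ⟨fun s => μ.map (drivenPath s),
    fun s => Measure.isProbabilityMeasure_map (hdm s).aemeasurable, fun s A => ?_, fun s A T => ?_⟩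
  · rw [Measure.map_apply (hdm s) (hset A 0)]
    by_cases h : s ∈ A 0 <;> simp [Set.preimage, drivenPath, h]
  · have hμ : μ = _ := (infinitePi_eq_map_cons ν).symm
    have hcons : Measurable fun (p : (S → S) × (ℕ → S → S)) (k : ℕ) =>
        Nat.casesOn (motive := fun _ => S → S) k p.1 p.2 := by
      refine measurable_pi_lambda _ fun k => ?_
      cases k with
      | zero => exact measurable_fst
      | succ k => exact (measurable_pi_apply k).comp measurable_snd
    have hpath : ∀ (a : S → S) (ξ : ℕ → S → S),
        (∀ t ≤ T + 1, drivenPath s (fun k => Nat.casesOn (motive := fun _ => S → S) k a ξ) t ∈ A t)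
          ↔ s ∈ A 0 ∧ ∀ t ≤ T, drivenPath (a s) ξ t ∈ A (t + 1) := by
      intro a ξ
      constructor
      · intro h
        refine ⟨h 0 (Nat.zero_le _), fun t ht => ?_⟩
        have h1 := h (t + 1) (by omega)
        rw [drivenPath_succ_eq] at h1
        exact h1
      · rintro ⟨h0, h1⟩ t ht
        cases t with
        | zero => exact h0
        | succ t =>
          rw [drivenPath_succ_eq]
          exact h1 t (by omega)
    rw [Measure.map_apply (hdm s) (hset A _), hμ,
      Measure.map_apply hcons (hdm s (hset A _)),
      Measure.prod_apply (hcons (hdm s (hset A _)))]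
    by_cases h : s ∈ A 0
    · rw [Set.indicator_of_mem h, ← (measurePreserving_eval Q s).lintegral_comp
        (measurable_of_countable _)]
      refine lintegral_congr fun a => ?_
      rw [← hμ, Measure.map_apply (hdm _) (hset (fun t => A (t + 1)) T)]
      congr 1
      ext ξ
      simp only [Set.mem_preimage, Set.mem_ofPred_eq, hpath, h, true_and, Function.eval]
    · rw [Set.indicator_of_notMem h]
      simp [Set.preimage, hpath, h]

open MeasureTheory in
/-- If a function of a Markov chain has transition probabilities depending only on its current
value, then its finite-dimensional distributions are those of a Markov chain. -/
theorem markovChain_cylinder {S C : Type*} [Finite S] [DecidableEq C] [MeasurableSpace S]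
    [MeasurableSingletonClass S] {Q : S → Measure S} {P : S → Measure (ℕ → S)}
    (hP₀ : ∀ s (A : ℕ → Set S), P s {ω | ∀ t ≤ 0, ω t ∈ A t} = (A 0).indicator 1 s)
    (hP₁ : ∀ s (A : ℕ → Set S) (T : ℕ), P s {ω | ∀ t ≤ T + 1, ω t ∈ A t} =
      (A 0).indicator (fun _ => ∫⁻ s', P s' {ω | ∀ t ≤ T, ω t ∈ A (t + 1)} ∂Q s) s)
    (φ : S → C) {K : C → C → ℝ} (hK : ∀ a b, 0 ≤ K a b)
    (hφ : ∀ s η, Q s {s' | φ s' = η} = ENNReal.ofReal (K (φ s) η)) (T : ℕ) (s : S) (w : ℕ → C) :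
    P s {ω | ∀ t ≤ T, φ (ω t) = w t} = ENNReal.ofReal ((if w 0 = φ s then 1 else 0) *
      ∏ t ∈ Finset.range T, K (w t) (w (t + 1))) := by
  induction T generalizing s w with
  | zero =>
    refine (hP₀ s fun t => {s' | φ s' = w t}).trans ?_
    by_cases h : φ s = w 0 <;> simp [h, eq_comm]
  | succ T ih =>
    refine (hP₁ s (fun t => {s' | φ s' = w t}) T).trans ?_
    by_cases h : φ s = w 0
    · rw [Set.indicator_of_mem (by exact h)]
      set c : ℝ := ∏ t ∈ Finset.range T, K (w (t + 1)) (w (t + 1 + 1)) with hc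
      have hint : ∀ s', P s' {ω | ∀ t ≤ T, ω t ∈ {s' | φ s' = w (t + 1)}} =
          {s' | φ s' = w 1}.indicator (fun _ => ENNReal.ofReal c) s' := fun s' => by
        refine (ih s' fun t => w (t + 1)).trans ?_
        by_cases h' : φ s' = w 1 <;> simp [h', hc, eq_comm]
      rw [lintegral_congr hint, lintegral_indicator_const (Set.toFinite _).measurableSet, hφ,
        ← ENNReal.ofReal_mul (Finset.prod_nonneg fun _ _ => hK _ _), Finset.prod_range_succ', h]
      simp
    · rw [Set.indicator_of_notMem (by exact h)]
      simp [Ne.symm h]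

open MeasureTheory in
/-- A function contracted on average by a Markov chain controls the probability of avoiding its
zero set. -/
theorem markovChain_avoid_le {S : Type*} [Finite S] [MeasurableSpace S]
    [MeasurableSingletonClass S] {Q : S → Measure S} {P : S → Measure (ℕ → S)}
    (hP₀ : ∀ s (A : ℕ → Set S), P s {ω | ∀ t ≤ 0, ω t ∈ A t} = (A 0).indicator 1 s)
    (hP₁ : ∀ s (A : ℕ → Set S) (T : ℕ), P s {ω | ∀ t ≤ T + 1, ω t ∈ A t} =
      (A 0).indicator (fun _ => ∫⁻ s', P s' {ω | ∀ t ≤ T, ω t ∈ A (t + 1)} ∂Q s) s)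
    {B : Set S} {D : S → ℝ} (hDB : ∀ s ∈ B, 1 ≤ D s) {ρ : ℝ} (hρ : 0 ≤ ρ)
    (hD : ∀ s, ∫⁻ s', ENNReal.ofReal (D s') ∂Q s ≤ ENNReal.ofReal (ρ * D s)) (T : ℕ) (s : S) :
    P s {ω | ∀ t ≤ T, ω t ∈ B} ≤ ENNReal.ofReal (ρ ^ T * D s) := by
  induction T generalizing s with
  | zero =>
    rw [hP₀ s fun _ => B]
    by_cases h : s ∈ B
    · simpa [h] using hDB s h
    · simp [h]
  | succ T ih =>
    rw [hP₁ s (fun _ => B) T]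
    refine Set.indicator_apply_le' (fun _ => ?_) (fun _ => zero_le)
    calc ∫⁻ s', P s' {ω | ∀ t ≤ T, ω t ∈ B} ∂Q s
        ≤ ∫⁻ s', ENNReal.ofReal (ρ ^ T) * ENNReal.ofReal (D s') ∂Q s :=
          lintegral_mono fun s' => (ih s').trans_eq (ENNReal.ofReal_mul (pow_nonneg hρ T))
      _ = ENNReal.ofReal (ρ ^ T) * ∫⁻ s', ENNReal.ofReal (D s') ∂Q s :=
          lintegral_const_mul _ (measurable_of_finite _)
      _ ≤ ENNReal.ofReal (ρ ^ T) * ENNReal.ofReal (ρ * D s) := by gcongr; exact hD s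
      _ = ENNReal.ofReal (ρ ^ (T + 1) * D s) := by
          rw [← ENNReal.ofReal_mul (pow_nonneg hρ T)]
          ring_nf

theorem pPlus_eq (β s : ℝ) : pPlus β s = 1 / (1 + exp (-(2 * (β * s)))) := by
  rw [pPlus, Real.tanh_eq_sinh_div_cosh, Real.sinh_eq, Real.cosh_eq,
    show -(2 * (β * s)) = -(β * s) + -(β * s) by ring, exp_add, exp_neg]
  have := exp_pos (β * s)
  field_simp
  ring

theorem one_sub_pPlus (β s : ℝ) : 1 - pPlus β s = pPlus β (-s) := by
  rw [pPlus, pPlus, mul_neg, Real.tanh_neg]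
  ring

theorem le_pPlus {β s : ℝ} (hβ : 0 ≤ β) (hs : |s| ≤ 1) : 1 / (1 + exp (2 * β)) ≤ pPlus β s := by
  rw [pPlus_eq]
  have : -(2 * (β * s)) ≤ 2 * β := by nlinarith [(abs_le.1 hs).1]
  gcongr

theorem pPlus_nonneg (β s : ℝ) : 0 ≤ pPlus β s := by
  rw [pPlus_eq]
  positivity

theorem one_sub_pPlus_nonneg (β s : ℝ) : 0 ≤ 1 - pPlus β s :=
  (pPlus_nonneg β (-s)).trans_eq (one_sub_pPlus β s).symm

theorem abs_mag_sub_spin_le {n : ℕ} (σ : Config n) (i : Fin n) :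
    |mag σ - spin σ i / n| ≤ 1 := by
  have hn : (0 : ℝ) < n := by exact_mod_cast i.pos
  rw [mag, ← sub_div, ← Finset.sum_erase_eq_sub (Finset.mem_univ i), abs_div, Nat.abs_cast,
    div_le_one hn]
  calc |∑ j ∈ Finset.univ.erase i, spin σ j|
      ≤ ∑ j ∈ Finset.univ.erase i, |spin σ j| := Finset.abs_sum_le_sum_abs _ _
    _ ≤ ∑ j ∈ Finset.univ.erase i, (1 : ℝ) :=
        Finset.sum_le_sum fun j _ => by unfold spin; split_ifs <;> simp
    _ ≤ n := by simp

/-- Configurations of equal magnetization are matched by a permutation fixing the sites where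
they agree. -/
theorem exists_matching {n : ℕ} {σ τ : Config n} (h : mag σ = mag τ) :
    ∃ f : Equiv.Perm (Fin n), (∀ i, τ (f i) = σ i) ∧ ∀ i, σ i = τ i → f i = i := by
  rcases Nat.eq_zero_or_pos n with rfl | hn
  · exact ⟨1, fun i => i.elim0, fun i => i.elim0⟩
  have hsum : ∑ i, spin σ i = ∑ i, spin τ i := by
    have : (n : ℝ) ≠ 0 := by exact_mod_cast hn.ne'
    simpa [mag, this] using h
  have hcard : Fintype.card {i // σ i = true ∧ τ i = false} =
      Fintype.card {i // σ i = false ∧ τ i = true} := by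
    have hterm : ∀ i, spin σ i - spin τ i =
        2 * ((if σ i = true ∧ τ i = false then 1 else 0) -
          if σ i = false ∧ τ i = true then 1 else 0) := fun i => by
      unfold spin
      cases σ i <;> cases τ i <;> norm_num
    have h0 := sub_eq_zero.2 hsum
    rw [← Finset.sum_sub_distrib, Finset.sum_congr rfl fun i _ => hterm i, ← Finset.mul_sum,
      Finset.sum_sub_distrib, Finset.sum_boole, Finset.sum_boole] at h0
    rw [Fintype.card_subtype, Fintype.card_subtype]
    rw [← Nat.cast_inj (R := ℝ)]
    linarith
  have hfib : ∀ c : Bool, Nonempty ({a : {i // σ i ≠ τ i} // σ a = c} ≃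
      {a : {i // σ i ≠ τ i} // τ a = c}) := by
    intro c
    refine Fintype.card_eq.1 ?_
    rw [Fintype.card_congr (Equiv.subtypeSubtypeEquivSubtypeInter _ fun i => σ i = c),
      Fintype.card_congr (Equiv.subtypeSubtypeEquivSubtypeInter _ fun i => τ i = c)]
    cases c
    · convert hcard.symm using 4 with i i
      all_goals cases σ i <;> cases τ i <;> simp
    · convert hcard using 4 with i i
      all_goals cases σ i <;> cases τ i <;> simp
  let e := fun c => (hfib c).some
  refine ⟨Equiv.Perm.ofSubtype (Equiv.ofFiberEquiv e), fun i => ?_, fun i hi => ?_⟩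
  · by_cases hi : σ i = τ i
    · rw [Equiv.Perm.ofSubtype_apply_of_not_mem (p := fun i => σ i ≠ τ i) _ (not_not_intro hi), hi]
    · rw [Equiv.Perm.ofSubtype_apply_of_mem (p := fun i => σ i ≠ τ i) _ hi]
      exact Equiv.ofFiberEquiv_map e ⟨i, hi⟩
  · exact Equiv.Perm.ofSubtype_apply_of_not_mem (p := fun i => σ i ≠ τ i) _ (not_not_intro hi)

/-- Pairs of configurations of equal magnetization. -/
abbrev MagPair (n : ℕ) := {z : Config n × Config n // mag z.1 = mag z.2}

namespace MagPair

variable {n : ℕ}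

/-- A chosen matching of the two configurations, fixing the sites where they agree. -/
def matching (z : MagPair n) : Equiv.Perm (Fin n) := (exists_matching z.2).choose

theorem snd_matching (z : MagPair n) (i : Fin n) : z.1.2 (z.matching i) = z.1.1 i :=
  (exists_matching z.2).choose_spec.1 i

theorem matching_of_eq (z : MagPair n) {i : Fin n} (h : z.1.1 i = z.1.2 i) : z.matching i = i :=
  (exists_matching z.2).choose_spec.2 i h

/-- Set the spin at `i` in the first configuration and at the site matched to `i` in the second
one to the same value. -/
def step (z : MagPair n) (i : Fin n) (b : Bool) : MagPair n :=
  ⟨(Function.update z.1.1 i b, Function.update z.1.2 (z.matching i) b), by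
    rw [mag, mag, ← Equiv.sum_comp z.matching (spin (Function.update z.1.2 _ b))]
    congr 1
    refine Finset.sum_congr rfl fun j _ => ?_
    by_cases h : j = i <;> simp [spin, h, snd_matching]⟩

theorem ne_of_step_ne (z : MagPair n) (i : Fin n) (b : Bool) {j : Fin n}
    (h : (z.step i b).1.1 j ≠ (z.step i b).1.2 j) : z.1.1 j ≠ z.1.2 j := by
  intro hj
  have hm := z.matching_of_eq hj
  apply h
  by_cases hji : j = i
  · subst hji
    simp [step, hm]
  · have : j ≠ z.matching i := fun h' => hji (z.matching.injective (hm.trans h'))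
    simp [step, hji, this, hj]

theorem step_eq_of_ne (z : MagPair n) {i : Fin n} {b : Bool} (hi : z.1.1 i ≠ z.1.2 i)
    (hb : b ≠ z.1.1 i) : (z.step i b).1.1 i = (z.step i b).1.2 i := by
  have hm : i ≠ z.matching i := fun h => hi (by rw [← z.snd_matching i, ← h])
  simp only [step, Function.update_self, Function.update_of_ne hm]
  revert hi hb
  cases b <;> cases z.1.1 i <;> cases z.1.2 i <;> simp

theorem hammingDist_step_le (z : MagPair n) (i : Fin n) (b : Bool) :
    hammingDist (z.step i b).1.1 (z.step i b).1.2 ≤ hammingDist z.1.1 z.1.2 :=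
  Finset.card_le_card (Finset.monotone_filter_right _ fun _ _ h => z.ne_of_step_ne i b h)

theorem hammingDist_step_lt (z : MagPair n) {i : Fin n} {b : Bool} (hi : z.1.1 i ≠ z.1.2 i)
    (hb : b ≠ z.1.1 i) :
    hammingDist (z.step i b).1.1 (z.step i b).1.2 < hammingDist z.1.1 z.1.2 := by
  refine Finset.card_lt_card ⟨Finset.monotone_filter_right _ fun _ _ h => z.ne_of_step_ne i b h,
    fun h => ?_⟩
  have := h (Finset.mem_filter.2 ⟨Finset.mem_univ i, hi⟩)
  exact (Finset.mem_filter.1 this).2 (z.step_eq_of_ne hi hb)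

/-- The probability that site `i` of the first configuration is set to `+1` when refreshed. -/
def plusProb (β : ℝ) (z : MagPair n) (i : Fin n) : ℝ :=
  pPlus β (mag z.1.1 - spin z.1.1 i / n)

/-- The one-step law of the coupling that refreshes matched sites to the same spin. -/
def kernel (β : ℝ) (z : MagPair n) : MeasureTheory.Measure (MagPair n) :=
  ∑ i : Fin n, (ENNReal.ofReal (1 / n * z.plusProb β i) • .dirac (z.step i true) +
    ENNReal.ofReal (1 / n * (1 - z.plusProb β i)) • .dirac (z.step i false))

open MeasureTheory in
theorem lintegral_kernel (β : ℝ) (z : MagPair n) {g : MagPair n → ℝ} (hg : ∀ z, 0 ≤ g z) :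
    ∫⁻ z', ENNReal.ofReal (g z') ∂kernel β z = ENNReal.ofReal (1 / n * ∑ i : Fin n,
      (z.plusProb β i * g (z.step i true) + (1 - z.plusProb β i) * g (z.step i false))) := by
  have h1 : ∀ i, 0 ≤ 1 / n * z.plusProb β i := fun i =>
    mul_nonneg (by positivity) (pPlus_nonneg _ _)
  have h2 : ∀ i, 0 ≤ 1 / n * (1 - z.plusProb β i) := fun i =>
    mul_nonneg (by positivity) (one_sub_pPlus_nonneg _ _)
  rw [kernel, lintegral_finsetSum_measure, Finset.mul_sum, ENNReal.ofReal_sum_of_nonneg]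
  · refine Finset.sum_congr rfl fun i _ => ?_
    rw [lintegral_add_measure, lintegral_smul_measure, lintegral_smul_measure, lintegral_dirac,
      lintegral_dirac, smul_eq_mul, smul_eq_mul, ← ENNReal.ofReal_mul (h1 i),
      ← ENNReal.ofReal_mul (h2 i), ← ENNReal.ofReal_add (mul_nonneg (h1 i) (hg _))
        (mul_nonneg (h2 i) (hg _))]
    ring_nf
  · intro i _
    rw [mul_add, ← mul_assoc, ← mul_assoc]
    exact add_nonneg (mul_nonneg (h1 i) (hg _)) (mul_nonneg (h2 i) (hg _))

open MeasureTheory in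
theorem kernel_apply (β : ℝ) (z : MagPair n) (p : MagPair n → Prop) [DecidablePred p] :
    kernel β z {z' | p z'} = ENNReal.ofReal (1 / n * ∑ i : Fin n,
      (z.plusProb β i * (if p (z.step i true) then 1 else 0) +
        (1 - z.plusProb β i) * (if p (z.step i false) then 1 else 0))) := by
  rw [← lintegral_kernel (g := fun z' => if p z' then 1 else 0) β z
    (fun _ => by split_ifs <;> simp), ← lintegral_indicator_one (Set.toFinite _).measurableSet]
  refine lintegral_congr fun z' => ?_
  by_cases h : p z' <;> simp [h]

instance [NeZero n] (β : ℝ) (z : MagPair n) : MeasureTheory.IsProbabilityMeasure (kernel β z) := by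
  constructor
  have := kernel_apply β z fun _ => True
  simpa [NeZero.ne] using this

theorem glauberKernel_eq_sum_update (β : ℝ) (σ η : Config n) :
    glauberKernel β n σ η = 1 / n * ∑ i : Fin n,
      (pPlus β (mag σ - spin σ i / n) * (if Function.update σ i true = η then 1 else 0) +
        (1 - pPlus β (mag σ - spin σ i / n)) *
          (if Function.update σ i false = η then 1 else 0)) := by
  rw [glauberKernel]
  congr 1
  refine Finset.sum_congr rfl fun i _ => ?_
  have hiff : ∀ b, Function.update σ i b = η ↔ (∀ j, j ≠ i → η j = σ j) ∧ η i = b := fun b => by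
    rw [Function.update_eq_iff]
    exact ⟨fun h => ⟨fun j hj => (h.2 j hj).symm, h.1.symm⟩,
      fun h => ⟨h.2.symm, fun j hj => (h.1 j hj).symm⟩⟩
  simp only [hiff]
  cases η i <;> simp

theorem kernel_fst (β : ℝ) (z : MagPair n) (η : Config n) :
    kernel β z {z' | z'.1.1 = η} = ENNReal.ofReal (glauberKernel β n z.1.1 η) := by
  rw [kernel_apply, glauberKernel_eq_sum_update]
  rfl

theorem kernel_snd (β : ℝ) (z : MagPair n) (η : Config n) :
    kernel β z {z' | z'.1.2 = η} = ENNReal.ofReal (glauberKernel β n z.1.2 η) := by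
  rw [kernel_apply, glauberKernel_eq_sum_update]
  conv_rhs => rw [← Equiv.sum_comp z.matching]
  simp only [plusProb, spin, snd_matching, z.2]
  rfl

theorem lintegral_hammingDist_le [NeZero n] {β : ℝ} (hβ : 0 ≤ β) (z : MagPair n) :
    ∫⁻ z', ENNReal.ofReal (hammingDist z'.1.1 z'.1.2) ∂kernel β z ≤
      ENNReal.ofReal ((1 - 1 / (1 + exp (2 * β)) / n) * hammingDist z.1.1 z.1.2) := by
  rw [lintegral_kernel β z fun z => Nat.cast_nonneg _]
  refine ENNReal.ofReal_le_ofReal ?_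
  have hn : (n : ℝ) ≠ 0 := NeZero.ne _
  set δ := 1 / (1 + exp (2 * β))
  set d : ℝ := ((hammingDist z.1.1 z.1.2 : ℕ) : ℝ) with hd
  have hterm : ∀ i, z.plusProb β i * (hammingDist (z.step i true).1.1 (z.step i true).1.2 : ℝ) +
      (1 - z.plusProb β i) * (hammingDist (z.step i false).1.1 (z.step i false).1.2 : ℝ) ≤
      d - δ * if z.1.1 i ≠ z.1.2 i then 1 else 0 := by
    intro i
    have hs := abs_mag_sub_spin_le z.1.1 i
    have h1 : δ ≤ z.plusProb β i := le_pPlus hβ hs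
    have h2 : δ ≤ 1 - z.plusProb β i :=
      (le_pPlus hβ (by rwa [abs_neg])).trans_eq (one_sub_pPlus β _).symm
    have hδ : 0 < δ := by positivity
    have hle : ∀ b, (hammingDist (z.step i b).1.1 (z.step i b).1.2 : ℝ) ≤ d := fun b => by
      rw [hd]
      exact_mod_cast z.hammingDist_step_le i b
    by_cases hi : z.1.1 i ≠ z.1.2 i
    · have hlt : ∀ b, b ≠ z.1.1 i →
          (hammingDist (z.step i b).1.1 (z.step i b).1.2 : ℝ) ≤ d - 1 := fun b hb => by
        rw [le_sub_iff_add_le, hd]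
        exact_mod_cast z.hammingDist_step_lt hi hb
      rw [if_pos hi]
      cases hz : z.1.1 i
      · nlinarith [hlt true (by simp [hz]), hle false]
      · nlinarith [hlt false (by simp [hz]), hle true]
    · rw [if_neg hi]
      nlinarith [hle true, hle false]
  calc 1 / n * ∑ i : Fin n, _
      ≤ 1 / n * ∑ i : Fin n, (d - δ * if z.1.1 i ≠ z.1.2 i then 1 else 0) := by
        gcongr with i
        exact hterm i
    _ = 1 / n * (n * d - δ * d) := by
        rw [Finset.sum_sub_distrib, ← Finset.mul_sum, Finset.sum_boole]
        simp [hd, hammingDist]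
    _ = (1 - δ / n) * d := by field_simp

end MagPair

theorem glauberKernel_nonneg (β : ℝ) {n : ℕ} (σ η : Config n) : 0 ≤ glauberKernel β n σ η := by
  unfold glauberKernel
  refine mul_nonneg (by positivity) (Finset.sum_nonneg fun i _ => ?_)
  split_ifs
  exacts [pPlus_nonneg _ _, one_sub_pPlus_nonneg _ _, le_rfl]

theorem pow_floor_mul_le {δ : ℝ} (hδ₀ : 0 < δ) (hδ₁ : δ ≤ 1) {n : ℕ} (hn : 3 ≤ n) :
    (1 - δ / n) ^ ⌊3 / δ * n * log n⌋₊ * n ≤ 1 / n := by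
  have hn3 : (3 : ℝ) ≤ n := by exact_mod_cast hn
  have hn0 : (0 : ℝ) < n := by linarith
  set T := ⌊3 / δ * n * log n⌋₊
  have hT : 3 / δ * n * log n ≤ T + 1 := (Nat.lt_floor_add_one _).le
  have hlog : 3 * log n - 1 ≤ T * (δ / n) := by
    have h1 : 3 * log n = (3 / δ * n * log n) * (δ / n) := by field_simp
    have h2 : δ / n ≤ 1 := by rw [div_le_one hn0]; linarith
    have h3 : 0 ≤ δ / n := by positivity
    nlinarith
  calc (1 - δ / n) ^ T * n ≤ exp (-(δ / n)) ^ T * n := by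
        gcongr
        · rw [sub_nonneg, div_le_one hn0]
          linarith
        · linarith [add_one_le_exp (-(δ / n))]
    _ = exp (-(T * (δ / n))) * n := by rw [← exp_nat_mul]; ring_nf
    _ ≤ exp (1 + -(3 * log n)) * n := by
        gcongr
        linarith
    _ = exp 1 / n ^ 3 * n := by
        rw [exp_add, exp_neg, show (3 : ℝ) * log n = (3 : ℕ) * log n by norm_num, exp_nat_mul,
          exp_log hn0, div_eq_mul_inv]
    _ = exp 1 / n ^ 2 := by field_simp
    _ ≤ n / n ^ 2 := by
        gcongr
        linarith [exp_one_lt_d9]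
    _ = 1 / n := by field_simp

/-- Coupling of chains with the same magnetization: for every `β ≥ 0` there is
a constant `c₀(β) > 0` such that for all large `n` and all configurations
`σ, σ'` with `S(σ) = S(σ')` there is a coupling of the Glauber dynamics
started from `σ` and `σ'` whose coupling time `τ = min{t : X_t = X̃_t}`
satisfies `P(τ > c₀ n log n) ≤ 1/n`. -/
theorem equal_mag_coupling (β : ℝ) (hβ : 0 ≤ β) :
    ∃ c₀ > (0 : ℝ), ∃ N : ℕ, ∀ n ≥ N, ∀ σ σ' : Config n, mag σ = mag σ' →
      ∃ P : MeasureTheory.Measure (ℕ → Config n × Config n),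
        IsPathCoupling β n σ σ' P ∧
        P {ω | ∀ t ≤ ⌊c₀ * n * Real.log n⌋₊, (ω t).1 ≠ (ω t).2} ≤
          ENNReal.ofReal (1 / n) := by
  set δ : ℝ := 1 / (1 + exp (2 * β)) with hδ
  have hδ₀ : 0 < δ := by positivity
  have hδ₁ : δ ≤ 1 := by
    rw [hδ, div_le_one (by positivity)]
    linarith [exp_pos (2 * β)]
  refine ⟨3 / δ, by positivity, 3, fun n hn σ σ' h => ?_⟩
  have : NeZero n := ⟨by omega⟩
  have hn3 : (3 : ℝ) ≤ n := by exact_mod_cast hn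
  obtain ⟨P, hP, hP₀, hP₁⟩ := exists_markovChain (MagPair.kernel (n := n) β)
  set z : MagPair n := ⟨(σ, σ'), h⟩
  have hval : Measurable fun (ω : ℕ → MagPair n) t => (ω t).1 :=
    measurable_pi_lambda _ fun t => measurable_subtype_coe.comp (measurable_pi_apply t)
  have hset : ∀ (p : ℕ → Config n × Config n → Prop) (T : ℕ),
      MeasurableSet {ω : ℕ → Config n × Config n | ∀ t ≤ T, p t (ω t)} := by
    intro p T
    simp only [Set.ofPred_forall]
    exact .iInter fun t => .iInter fun _ =>
      measurable_pi_apply t (Set.toFinite {x | p t x}).measurableSet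
  refine ⟨(P z).map fun ω t => (ω t).1,
    ⟨MeasureTheory.Measure.isProbabilityMeasure_map hval.aemeasurable, fun T w => ?_,
      fun T w => ?_⟩, ?_⟩
  · rw [MeasureTheory.Measure.map_apply hval (hset (fun t x => x.1 = w t) T)]
    exact markovChain_cylinder hP₀ hP₁ (fun z => z.1.1) (glauberKernel_nonneg β)
      (MagPair.kernel_fst β) T z w
  · rw [MeasureTheory.Measure.map_apply hval (hset (fun t x => x.2 = w t) T)]
    exact markovChain_cylinder hP₀ hP₁ (fun z => z.1.2) (glauberKernel_nonneg β)
      (MagPair.kernel_snd β) T z w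
  · rw [MeasureTheory.Measure.map_apply hval (hset (fun _ x => x.1 ≠ x.2) _)]
    have hρ : 0 ≤ 1 - δ / n := by
      rw [sub_nonneg, div_le_one (by linarith)]
      linarith
    refine (markovChain_avoid_le hP₀ hP₁ (B := {z | z.1.1 ≠ z.1.2})
      (D := fun z => hammingDist z.1.1 z.1.2)
      (fun z hz => by exact_mod_cast hammingDist_pos.2 hz) hρ
      (MagPair.lintegral_hammingDist_le hβ) _ z).trans (ENNReal.ofReal_le_ofReal ?_)
    refine le_trans ?_ (pow_floor_mul_le hδ₀ hδ₁ hn)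
    gcongr
    exact_mod_cast hammingDist_le_card_fintype.trans_eq (Fintype.card_fin n)

end

end CW
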